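/- Let X and Y be random vectors taking values in ℝ^d (no independence assumption). If X distributionally dominates Y, then X strictly first-order stochastically dominates Y, i.e. F_X(v) ≤ F_Y(v) for all v ∈ ℝ^d and F_X(v) < F_Y(v) for some v. -/

import Mathlib

open MeasureTheory
open scoped ProbabilityTheory

/-- Joint CDF of a random vector `X : Ω → Fin d → ℝ`. -/
noncomputable def jointCDF {Ω : Type*} [MeasureSpace Ω] {d : ℕ}
    (X : Ω → Fin d → ℝ) (v : Fin d → ℝ) : ℝ :=
  (ℙ {ω | ∀ i, X ω i ≤ v i}).toReal

/-- Marginal CDF of coordinate `i` of a random vector. -/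
noncomputable def margCDF {Ω : Type*} [MeasureSpace Ω] {d : ℕ}
    (X : Ω → Fin d → ℝ) (i : Fin d) (t : ℝ) : ℝ :=
  (ℙ {ω | X ω i ≤ t}).toReal

/-- `x` Pareto dominates `y`. -/
def ParetoDom {d : ℕ} (x y : Fin d → ℝ) : Prop :=
  (∀ i, y i ≤ x i) ∧ ∃ i, y i < x i

/-- A strictly monotonically increasing function on `ℝ^d`. -/
def StrictlyMonoIncr {d : ℕ} (u : (Fin d → ℝ) → ℝ) : Prop :=
  ∀ x y : Fin d → ℝ, ParetoDom x y → u y < u x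

/-- `X` first-order stochastically dominates `Y`. -/
def FSD {Ω : Type*} [MeasureSpace Ω] {d : ℕ} (X Y : Ω → Fin d → ℝ) : Prop :=
  ∀ v : Fin d → ℝ, jointCDF X v ≤ jointCDF Y v

/-- The marginal `X_i` strictly first-order stochastically dominates `Y_i`. -/
def MargStrictFSD {Ω : Type*} [MeasureSpace Ω] {d : ℕ}
    (X Y : Ω → Fin d → ℝ) (i : Fin d) : Prop :=
  (∀ t : ℝ, margCDF X i t ≤ margCDF Y i t) ∧ ∃ t : ℝ, margCDF X i t < margCDF Y i t

/-- `X` distributionally dominates `Y`. -/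
def DistDom {Ω : Type*} [MeasureSpace Ω] {d : ℕ} (X Y : Ω → Fin d → ℝ) : Prop :=
  FSD X Y ∧ ∃ i : Fin d, MargStrictFSD X Y i

/-- The marginal CDF is the limit of the joint CDF as the other coordinates tend to infinity. -/
theorem tendsto_jointCDF_update {Ω : Type*} [MeasureSpace Ω]
    [IsFiniteMeasure (ℙ : Measure Ω)] {d : ℕ} (X : Ω → Fin d → ℝ) (i : Fin d) (t : ℝ) :
    Filter.Tendsto (fun n : ℕ => jointCDF X (Function.update (fun _ => (n : ℝ)) i t))
      Filter.atTop (nhds (margCDF X i t)) := by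
  have hmono : Monotone fun n : ℕ =>
      {ω | ∀ j, X ω j ≤ Function.update (fun _ => (n : ℝ)) i t j} := by
    intro m n hmn ω hω j
    refine (hω j).trans ?_
    rcases eq_or_ne j i with rfl | hj
    · simp
    · simpa [hj] using hmn
  have hunion : ⋃ n : ℕ, {ω | ∀ j, X ω j ≤ Function.update (fun _ => (n : ℝ)) i t j} =
      {ω | X ω i ≤ t} := by
    ext ω
    simp only [Set.mem_iUnion, Set.mem_ofPred_eq]
    constructor
    · rintro ⟨n, hn⟩
      simpa using hn i
    · intro h
      obtain ⟨M, hM⟩ := (Set.finite_range (X ω)).bddAbove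
      obtain ⟨n, hn⟩ := exists_nat_ge M
      refine ⟨n, fun j => ?_⟩
      rcases eq_or_ne j i with rfl | hj
      · simpa using h
      · simpa [hj] using (hM (Set.mem_range_self j)).trans hn
  have hlim := tendsto_measure_iUnion_atTop (μ := (ℙ : Measure Ω)) hmono
  rw [hunion] at hlim
  exact (ENNReal.tendsto_toReal (measure_ne_top _ _)).comp hlim

/-- Distributional dominance implies strict first-order stochastic dominance
(no independence assumption needed). -/
theorem stmt12 {Ω : Type*} [MeasureSpace Ω] [IsProbabilityMeasure (ℙ : Measure Ω)]
    {d : ℕ} (X Y : Ω → Fin d → ℝ)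
    (hX : Measurable X) (hY : Measurable Y)
    (hdom : DistDom X Y) :
    (∀ v : Fin d → ℝ, jointCDF X v ≤ jointCDF Y v) ∧
      ∃ v : Fin d → ℝ, jointCDF X v < jointCDF Y v := by
  obtain ⟨hFSD, i, -, t, ht⟩ := hdom
  refine ⟨hFSD, ?_⟩
  by_contra! hle
  exact ht.not_ge (le_of_tendsto_of_tendsto' (tendsto_jointCDF_update Y i t)
    (tendsto_jointCDF_update X i t) fun n => hle _)
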